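/- If a tripartite state ρ_{ABC} saturates subadditivity in the form S_{ABC} = S_C − S_{AB}, then Δ_P(A:B:C) = S_A + S_B + S_{AB}. -/

import Mathlib

open scoped BigOperators ComplexOrder

noncomputable section

/-- Von Neumann entropy of a matrix: `−∑ λᵢ log λᵢ` over its eigenvalues
(defined to be `0` if the matrix is not Hermitian). -/
noncomputable def matEntropy {ι : Type} [Fintype ι] [DecidableEq ι]
    (ρ : Matrix ι ι ℂ) : ℝ :=
  if h : ρ.IsHermitian then ∑ i, Real.negMulLog (h.eigenvalues i) else 0

/-- A density matrix: positive semidefinite with unit trace. -/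
def IsDensityMatrix {ι : Type} [Fintype ι] (ρ : Matrix ι ι ℂ) : Prop :=
  ρ.PosSemidef ∧ ρ.trace = 1

instance sumElimFintype {κ π : Type} {α : κ → Type} {δ : π → Type}
    [∀ i, Fintype (α i)] [∀ k, Fintype (δ k)] :
    ∀ i : κ ⊕ π, Fintype (Sum.elim α δ i)
  | .inl a => inferInstanceAs (Fintype (α a))
  | .inr b => inferInstanceAs (Fintype (δ b))

instance sumElimDecEq {κ π : Type} {α : κ → Type} {δ : π → Type}
    [∀ i, DecidableEq (α i)] [∀ k, DecidableEq (δ k)] :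
    ∀ i : κ ⊕ π, DecidableEq (Sum.elim α δ i)
  | .inl a => inferInstanceAs (DecidableEq (α a))
  | .inr b => inferInstanceAs (DecidableEq (δ b))

/-- Reduced density matrix on the subsystems in `s` (partial trace over the rest). -/
noncomputable def reduce {κ : Type} [Fintype κ] [DecidableEq κ] {α : κ → Type}
    [∀ i, Fintype (α i)] (s : Finset κ)
    (ρ : Matrix (∀ i, α i) (∀ i, α i) ℂ) :
    Matrix (∀ i : {j // j ∈ s}, α i.1) (∀ i : {j // j ∈ s}, α i.1) ℂ :=
  Matrix.of fun f g => ∑ h : ∀ i : {j // j ∉ s}, α i.1,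
    ρ (fun i => if hi : i ∈ s then f ⟨i, hi⟩ else h ⟨i, hi⟩)
      (fun i => if hi : i ∈ s then g ⟨i, hi⟩ else h ⟨i, hi⟩)

/-- The (pure) density matrix `|ψ⟩⟨ψ|` of a state vector. -/
def vecState {ι : Type} (ψ : ι → ℂ) : Matrix ι ι ℂ :=
  Matrix.of fun x y => ψ x * star (ψ y)

/-- Multipartite mutual information `∑ᵢ S_{Aᵢ} − S_{A₁⋯Aₙ}`. -/
noncomputable def Imulti {κ : Type} [Fintype κ] [DecidableEq κ] {α : κ → Type}
    [∀ i, Fintype (α i)] [∀ i, DecidableEq (α i)]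
    (ρ : Matrix (∀ i, α i) (∀ i, α i) ℂ) : ℝ :=
  (∑ i, matEntropy (reduce {i} ρ)) - matEntropy ρ

/-- Merge an assignment on the original systems with one on the ancillas. -/
def mergeSum {κ π : Type} {α : κ → Type} {δ : π → Type}
    (f : ∀ i, α i) (h : ∀ k, δ k) : ∀ i : κ ⊕ π, Sum.elim α δ i
  | .inl a => f a
  | .inr b => h b

/-- The subsystems belonging to party `k` together with its ancilla. -/
def partyFinset {κ π : Type} [Fintype κ] [DecidableEq κ] [DecidableEq π]
    (p : κ → π) (k : π) : Finset (κ ⊕ π) :=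
  (Finset.univ.filter fun i => p i = k).image Sum.inl ∪ {Sum.inr k}

/-- `ψ` (on the original systems plus one ancilla `Fin (d k)` per party)
purifies `ρ`: tracing out all ancillas from `|ψ⟩⟨ψ|` gives back `ρ`. -/
def Purifies {κ π : Type} [Fintype κ] {α : κ → Type} [∀ i, Fintype (α i)]
    [Fintype π] [DecidableEq π] {d : π → ℕ}
    (ψ : (∀ i : κ ⊕ π, Sum.elim α (fun k => Fin (d k)) i) → ℂ)
    (ρ : Matrix (∀ i, α i) (∀ i, α i) ℂ) : Prop :=
  ∀ f g, (∑ h : ∀ k, Fin (d k), vecState ψ (mergeSum f h) (mergeSum g h)) = ρ f g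

/-- Multipartite entanglement of purification for the partition of the systems `κ`
into parties `π` given by `p`: the infimum over all purifications (with one ancilla
per party, of arbitrary finite dimension) of `∑ₖ S_{AₖAₖ'}`. -/
noncomputable def DeltaPart {κ π : Type} [Fintype κ] [DecidableEq κ]
    [Fintype π] [DecidableEq π] {α : κ → Type}
    [∀ i, Fintype (α i)] [∀ i, DecidableEq (α i)]
    (p : κ → π) (ρ : Matrix (∀ i, α i) (∀ i, α i) ℂ) : ℝ :=
  sInf { x | ∃ (d : π → ℕ) (ψ : (∀ i : κ ⊕ π, Sum.elim α (fun k => Fin (d k)) i) → ℂ),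
    Purifies ψ ρ ∧
    x = ∑ k : π, matEntropy (reduce (partyFinset p k) (vecState ψ)) }

/-- Bipartite-style entanglement of purification for the partition `p`:
the infimum over purifications of the entropy of the single party `k₀`
together with its ancilla. -/
noncomputable def EPart {κ π : Type} [Fintype κ] [DecidableEq κ]
    [Fintype π] [DecidableEq π] {α : κ → Type}
    [∀ i, Fintype (α i)] [∀ i, DecidableEq (α i)]
    (p : κ → π) (k₀ : π) (ρ : Matrix (∀ i, α i) (∀ i, α i) ℂ) : ℝ :=
  sInf { x | ∃ (d : π → ℕ) (ψ : (∀ i : κ ⊕ π, Sum.elim α (fun k => Fin (d k)) i) → ℂ),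
    Purifies ψ ρ ∧
    x = matEntropy (reduce (partyFinset p k₀) (vecState ψ)) }

/-- Assignments on three systems as triples. -/
def piThree (β : Fin 3 → Type) : β 0 × β 1 × β 2 ≃ ∀ i, β i where
  toFun p := fun | 0 => p.1 | 1 => p.2.1 | 2 => p.2.2
  invFun f := (f 0, f 1, f 2)
  left_inv _ := rfl
  right_inv f := by ext i; fin_cases i <;> rfl

/-- The reduced state on `X` of the vector `v` on `X × Y`. -/
def vecReduced {X Y : Type} [Fintype Y] (v : X → Y → ℂ) : Matrix X X ℂ :=
  Matrix.of fun x x' => ∑ y, v x y * star (v x' y)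

lemma matEntropy_eq_sum_roots {X : Type} [Fintype X] [DecidableEq X] {A : Matrix X X ℂ}
    (hA : A.IsHermitian) :
    matEntropy A = (A.charpoly.roots.map fun z => Real.negMulLog z.re).sum := by
  rw [matEntropy, dif_pos hA, hA.roots_charpoly_eq_eigenvalues, Multiset.map_map]
  simp

lemma matEntropy_submatrix {X Y : Type} [Fintype X] [DecidableEq X] [Fintype Y] [DecidableEq Y]
    (A : Matrix X X ℂ) (e : Y ≃ X) : matEntropy (A.submatrix e e) = matEntropy A := by
  by_cases hA : A.IsHermitian
  · rw [matEntropy_eq_sum_roots hA, matEntropy_eq_sum_roots (hA.submatrix e),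
      ← Matrix.charpoly_reindex e.symm A]
    rfl
  · have : ¬ (A.submatrix e e).IsHermitian := by
      intro h
      apply hA
      simpa using h.submatrix e.symm
    rw [matEntropy, matEntropy, dif_neg hA, dif_neg this]

lemma matEntropy_mul_conjTranspose {X Y : Type} [Fintype X] [DecidableEq X] [Fintype Y]
    [DecidableEq Y] (M : Matrix X Y ℂ) :
    matEntropy (M * M.conjTranspose) = matEntropy (M.conjTranspose * M) := by
  rw [matEntropy_eq_sum_roots (Matrix.isHermitian_mul_conjTranspose_self M),
    matEntropy_eq_sum_roots (Matrix.isHermitian_conjTranspose_mul_self M)]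
  have h := congrArg Polynomial.roots (Matrix.charpoly_mul_comm' M M.conjTranspose)
  have hne : ∀ (n : ℕ) {Z : Type} [Fintype Z] [DecidableEq Z] (B : Matrix Z Z ℂ),
      Polynomial.X ^ n * B.charpoly ≠ 0 := fun n _ _ _ B =>
    mul_ne_zero (pow_ne_zero _ Polynomial.X_ne_zero) (Matrix.charpoly_monic B).ne_zero
  rw [Polynomial.roots_mul (hne _ _), Polynomial.roots_mul (hne _ _)] at h
  have h' := congrArg (fun s : Multiset ℂ => (s.map fun z => Real.negMulLog z.re).sum) h
  simpa [Multiset.map_nsmul, Multiset.sum_nsmul] using h'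

lemma matEntropy_transpose {X : Type} [Fintype X] [DecidableEq X] (A : Matrix X X ℂ) :
    matEntropy A.transpose = matEntropy A := by
  by_cases hA : A.IsHermitian
  · rw [matEntropy_eq_sum_roots hA, matEntropy_eq_sum_roots hA.transpose,
      Matrix.charpoly_transpose]
  · have : ¬ A.transpose.IsHermitian := fun h => hA (by simpa using h.transpose)
    rw [matEntropy, matEntropy, dif_neg hA, dif_neg this]

lemma vecReduced_eq_mul {X Y : Type} [Fintype Y] (v : X → Y → ℂ) :
    vecReduced v = Matrix.of v * (Matrix.of v).conjTranspose := by
  ext x x'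
  simp [vecReduced, Matrix.mul_apply]

lemma posSemidef_vecReduced {X Y : Type} [Fintype X] [Fintype Y] (v : X → Y → ℂ) :
    (vecReduced v).PosSemidef := by
  rw [vecReduced_eq_mul]
  exact Matrix.posSemidef_self_mul_conjTranspose _

lemma matEntropy_vecReduced_flip {X Y : Type} [Fintype X] [DecidableEq X] [Fintype Y]
    [DecidableEq Y] (v : X → Y → ℂ) :
    matEntropy (vecReduced v) = matEntropy (vecReduced (flip v)) := by
  rw [vecReduced_eq_mul, matEntropy_mul_conjTranspose, ← matEntropy_transpose]
  congr 1
  ext y y'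
  simp [vecReduced, Matrix.mul_apply, flip, mul_comm]

lemma matEntropy_diagonalized {X : Type} [Fintype X] [DecidableEq X] (U : Matrix X X ℂ)
    (hU : U ∈ Matrix.unitaryGroup X ℂ) (d : X → ℝ) :
    matEntropy (U * Matrix.diagonal (fun i => (d i : ℂ)) * U.conjTranspose)
      = ∑ i, Real.negMulLog (d i) := by
  have hD : (Matrix.diagonal (fun i => (d i : ℂ))).IsHermitian := by
    rw [Matrix.isHermitian_diagonal_iff]
    intro i
    simp [isSelfAdjoint_iff]
  have hH := Matrix.isHermitian_mul_mul_conjTranspose U hD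
  have hUU : U.conjTranspose * U = 1 := Matrix.mem_unitaryGroup_iff'.mp hU
  rw [matEntropy_eq_sum_roots hH, Matrix.charpoly_mul_comm, ← mul_assoc, hUU, one_mul,
    Matrix.charpoly_diagonal, Polynomial.roots_prod _ _ (Finset.prod_ne_zero_iff.mpr fun i _ => Polynomial.X_sub_C_ne_zero _)]
  simp

lemma exists_diagonalization {X : Type} [Fintype X] [DecidableEq X] {A : Matrix X X ℂ}
    (hA : A.PosSemidef) : ∃ U ∈ Matrix.unitaryGroup X ℂ, ∃ d : X → ℝ, (∀ i, 0 ≤ d i) ∧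
      A = U * Matrix.diagonal (fun i => (d i : ℂ)) * U.conjTranspose :=
  ⟨hA.1.eigenvectorUnitary, hA.1.eigenvectorUnitary.2, hA.1.eigenvalues, hA.eigenvalues_nonneg,
    by simpa using! hA.1.spectral_theorem⟩

lemma matEntropy_reduce {κ : Type} [Fintype κ] [DecidableEq κ] {α : κ → Type}
    [∀ i, Fintype (α i)] [∀ i, DecidableEq (α i)] (s : Finset κ)
    (ρ : Matrix (∀ i, α i) (∀ i, α i) ℂ) {X Y : Type} [Fintype X] [DecidableEq X] [Fintype Y]
    [Nonempty X] [Nonempty Y] (F : X × Y ≃ ∀ i, α i)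
    (hX : ∀ x y y', ∀ i ∈ s, F (x, y) i = F (x, y') i)
    (hY : ∀ x x' y, ∀ i ∉ s, F (x, y) i = F (x', y) i) :
    matEntropy (reduce s ρ)
      = matEntropy (Matrix.of fun x x' => ∑ y, ρ (F (x, y)) (F (x', y))) := by
  obtain ⟨x₀⟩ := ‹Nonempty X›
  obtain ⟨y₀⟩ := ‹Nonempty Y›
  have key : ∀ (f : ∀ i : {j // j ∈ s}, α i.1) (g : ∀ i : {j // j ∉ s}, α i.1), ∃ x y,
      (∀ i (hi : i ∈ s), F (x, y) i = f ⟨i, hi⟩) ∧ (∀ i (hi : i ∉ s), F (x, y) i = g ⟨i, hi⟩) := by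
    intro f g
    refine ⟨(F.symm fun i => if hi : i ∈ s then f ⟨i, hi⟩ else g ⟨i, hi⟩).1,
      (F.symm fun i => if hi : i ∈ s then f ⟨i, hi⟩ else g ⟨i, hi⟩).2, ?_, ?_⟩ <;>
    · intro i hi
      simp [hi]
  let eX : X ≃ ∀ i : {j // j ∈ s}, α i.1 := Equiv.ofBijective (fun x i => F (x, y₀) i) <| by
    constructor
    · intro x x' h
      have : F (x, y₀) = F (x', y₀) := by
        funext i
        by_cases hi : i ∈ s
        · exact congrFun h ⟨i, hi⟩
        · exact hY _ _ _ i hi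
      exact congrArg Prod.fst (F.injective this)
    · intro f
      obtain ⟨x, y, h, -⟩ := key f (fun i => F (x₀, y₀) i)
      exact ⟨x, funext fun i => (hX _ _ y i i.2).trans (h i i.2)⟩
  let eY : Y ≃ ∀ i : {j // j ∉ s}, α i.1 := Equiv.ofBijective (fun y i => F (x₀, y) i) <| by
    constructor
    · intro y y' h
      have : F (x₀, y) = F (x₀, y') := by
        funext i
        by_cases hi : i ∈ s
        · exact hX _ _ _ i hi
        · exact congrFun h ⟨i, hi⟩
      exact congrArg Prod.snd (F.injective this)
    · intro g
      obtain ⟨x, y, -, h⟩ := key (fun i => F (x₀, y₀) i) g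
      exact ⟨y, funext fun i => (hY _ x _ i i.2).trans (h i i.2)⟩
  have glue : ∀ x y, (fun i => if hi : i ∈ s then eX x ⟨i, hi⟩ else eY y ⟨i, hi⟩) = F (x, y) := by
    intro x y
    funext i
    split_ifs with hi
    · exact hX _ _ _ i hi
    · exact hY _ _ _ i hi
  rw [← matEntropy_submatrix _ eX]
  congr 1
  ext x x'
  simp only [reduce, Matrix.submatrix_apply, Matrix.of_apply]
  rw [← eY.sum_comp]
  simp only [glue]

lemma trace_diagonalized {X : Type} [Fintype X] [DecidableEq X] {U : Matrix X X ℂ}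
    (hU : U ∈ Matrix.unitaryGroup X ℂ) (d : X → ℝ) :
    (U * Matrix.diagonal (fun i => (d i : ℂ)) * U.conjTranspose).trace = ((∑ i, d i : ℝ) : ℂ) := by
  have hUU : U.conjTranspose * U = 1 := Matrix.mem_unitaryGroup_iff'.mp hU
  rw [Matrix.trace_mul_comm, ← mul_assoc, hUU, one_mul, Matrix.trace_diagonal]
  push_cast
  rfl

lemma matEntropy_nonneg {X : Type} [Fintype X] [DecidableEq X] {A : Matrix X X ℂ}
    (hA : IsDensityMatrix A) : 0 ≤ matEntropy A := by
  obtain ⟨U, hU, d, hd, rfl⟩ := exists_diagonalization hA.1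
  have hs : ∑ i, d i = 1 := by exact_mod_cast (trace_diagonalized hU d).symm.trans hA.2
  rw [matEntropy_diagonalized U hU]
  refine Finset.sum_nonneg fun i _ => Real.negMulLog_nonneg (hd i) ?_
  rw [← hs]
  exact Finset.single_le_sum (fun j _ => hd j) (Finset.mem_univ i)

lemma kronecker_diagonalized {X Y : Type} [Fintype X] [DecidableEq X] [Fintype Y]
    [DecidableEq Y] (U : Matrix X X ℂ) (V : Matrix Y Y ℂ) (a : X → ℝ) (b : Y → ℝ) :
    Matrix.kronecker (U * Matrix.diagonal (fun i => (a i : ℂ)) * U.conjTranspose)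
        (V * Matrix.diagonal (fun j => (b j : ℂ)) * V.conjTranspose)
      = Matrix.kronecker U V * Matrix.diagonal (fun p => ((a p.1 * b p.2 : ℝ) : ℂ))
        * (Matrix.kronecker U V).conjTranspose := by
  simp only [Matrix.kronecker, Matrix.conjTranspose_kronecker, Matrix.mul_kronecker_mul]
  congr 2
  push_cast
  exact Matrix.diagonal_kronecker_diagonal _ _

lemma matEntropy_kronecker {X Y : Type} [Fintype X] [DecidableEq X] [Fintype Y] [DecidableEq Y]
    {A : Matrix X X ℂ} {B : Matrix Y Y ℂ} (hA : IsDensityMatrix A) (hB : IsDensityMatrix B) :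
    matEntropy (Matrix.kronecker A B) = matEntropy A + matEntropy B := by
  obtain ⟨U, hU, a, -, rfl⟩ := exists_diagonalization hA.1
  obtain ⟨V, hV, b, -, rfl⟩ := exists_diagonalization hB.1
  have ha : ∑ i, a i = 1 := by exact_mod_cast (trace_diagonalized hU a).symm.trans hA.2
  have hb : ∑ i, b i = 1 := by exact_mod_cast (trace_diagonalized hV b).symm.trans hB.2
  rw [kronecker_diagonalized, matEntropy_diagonalized U hU, matEntropy_diagonalized V hV,
    matEntropy_diagonalized (Matrix.kronecker U V) (Matrix.kronecker_mem_unitary hU hV)]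
  simp only [Real.negMulLog_mul, Fintype.sum_prod_type, Finset.sum_add_distrib,
    ← Finset.sum_mul, ← Finset.mul_sum, ha, hb, one_mul]

/-- Equality case of Klein's inequality, for diagonalized matrices. -/
lemma eq_of_klein_eq {X : Type} [Fintype X] [DecidableEq X] {W V : Matrix X X ℂ}
    (hW : W ∈ Matrix.unitaryGroup X ℂ) (hV : V ∈ Matrix.unitaryGroup X ℂ) {p q : X → ℝ}
    (hp : ∀ k, 0 ≤ p k) (hq : ∀ l, 0 ≤ q l) (hpq : ∑ k, p k = ∑ l, q l) {r : X → ℝ}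
    (hr : ∀ l, r l = ((V.conjTranspose * (W * Matrix.diagonal (fun i => (p i : ℂ))
      * W.conjTranspose) * V) l l).re)
    (h0 : ∀ l, q l = 0 → r l = 0)
    (hS : ∑ k, p k * Real.log (p k) = ∑ l, r l * Real.log (q l)) :
    W * Matrix.diagonal (fun i => (p i : ℂ)) * W.conjTranspose
      = V * Matrix.diagonal (fun i => (q i : ℂ)) * V.conjTranspose := by
  have hW₁ : W * W.conjTranspose = 1 := Matrix.mem_unitaryGroup_iff.mp hW
  have hW₂ : W.conjTranspose * W = 1 := Matrix.mem_unitaryGroup_iff'.mp hW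
  have hV₁ : V * V.conjTranspose = 1 := Matrix.mem_unitaryGroup_iff.mp hV
  have hV₂ : V.conjTranspose * V = 1 := Matrix.mem_unitaryGroup_iff'.mp hV
  set U := W.conjTranspose * V with hU
  have hUH : U.conjTranspose = V.conjTranspose * W := by simp [hU]
  have hU₁ : U * U.conjTranspose = 1 := by
    rw [hUH, hU, mul_assoc, ← mul_assoc V, hV₁, one_mul, hW₂]
  have hU₂ : U.conjTranspose * U = 1 := by
    rw [hUH, hU, mul_assoc, ← mul_assoc W, hW₁, one_mul, hV₂]
  have hrow : ∀ k, ∑ l, Complex.normSq (U k l) = 1 := by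
    intro k
    have := congrFun (congrFun hU₁ k) k
    simp only [Matrix.mul_apply, Matrix.conjTranspose_apply, Matrix.one_apply_eq,
      RCLike.star_def, Complex.mul_conj] at this
    exact_mod_cast this
  have hcol : ∀ l, ∑ k, Complex.normSq (U k l) = 1 := by
    intro l
    have := congrFun (congrFun hU₂ l) l
    simp only [Matrix.mul_apply, Matrix.conjTranspose_apply, Matrix.one_apply_eq,
      RCLike.star_def, mul_comm, Complex.mul_conj] at this
    exact_mod_cast this
  have hr' : ∀ l, r l = ∑ k, p k * Complex.normSq (U k l) := by
    intro l
    have : V.conjTranspose * (W * Matrix.diagonal (fun i => (p i : ℂ)) * W.conjTranspose) * V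
        = U.conjTranspose * (Matrix.diagonal (fun i => (p i : ℂ)) * U) := by
      rw [hUH, hU]
      simp only [mul_assoc]
    rw [hr, this, Matrix.mul_apply, Complex.re_sum]
    refine Finset.sum_congr rfl fun k _ => ?_
    rw [Matrix.diagonal_mul, Matrix.conjTranspose_apply, RCLike.star_def,
      mul_left_comm, ← Complex.normSq_eq_conj_mul_self, ← Complex.ofReal_mul, Complex.ofReal_re]
  have hsupp : ∀ k l, q l = 0 → Complex.normSq (U k l) = 0 ∨ p k = 0 := by
    intro k l hql
    have h := h0 l hql
    rw [hr', Finset.sum_eq_zero_iff_of_nonneg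
      fun k _ => mul_nonneg (hp k) (Complex.normSq_nonneg _)] at h
    exact (mul_eq_zero.mp (h k (Finset.mem_univ k))).symm
  have hterm : ∀ a b : ℝ, 0 ≤ a → 0 < b →
      0 ≤ a * Real.log a - a * Real.log b - a + b ∧
      (a * Real.log a - a * Real.log b - a + b = 0 → a = b) := by
    intro a b ha hb
    rcases ha.eq_or_lt with rfl | ha
    · simp [hb.le, hb.ne, hb.ne']
    · have hlog : Real.log (b / a) = Real.log b - Real.log a := Real.log_div hb.ne' ha.ne'
      have hmul : a * (b / a) = b := by field_simp
      constructor
      · nlinarith [Real.log_le_sub_one_of_pos (div_pos hb ha)]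
      · intro h
        by_contra hne
        have h1 : b / a ≠ 1 := fun h' => hne ((div_eq_one_iff_eq ha.ne').mp h').symm
        nlinarith [Real.log_lt_sub_one_of_pos (div_pos hb ha) h1]
  let t : X → X → ℝ := fun k l => Complex.normSq (U k l) *
    (p k * Real.log (p k) - p k * Real.log (q l) - p k + q l)
  have ht : ∀ k l, 0 ≤ t k l := by
    intro k l
    rcases (hq l).eq_or_lt with h | h
    · rcases hsupp k l h.symm with h' | h' <;> simp [t, h', ← h]
    · exact mul_nonneg (Complex.normSq_nonneg _) (hterm _ _ (hp k) h).1
  have hsum : ∑ k, ∑ l, t k l = 0 := by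
    have e1 : ∑ k, ∑ l, Complex.normSq (U k l) * (p k * Real.log (p k))
        = ∑ k, p k * Real.log (p k) := by
      simp only [← Finset.sum_mul, hrow, one_mul]
    have e2 : ∑ k, ∑ l, Complex.normSq (U k l) * (p k * Real.log (q l))
        = ∑ l, r l * Real.log (q l) := by
      rw [Finset.sum_comm]
      refine Finset.sum_congr rfl fun l _ => ?_
      rw [hr', Finset.sum_mul]
      exact Finset.sum_congr rfl fun k _ => by ring
    have e3 : ∑ k, ∑ l, Complex.normSq (U k l) * p k = ∑ k, p k := by
      simp only [← Finset.sum_mul, hrow, one_mul]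
    have e4 : ∑ k, ∑ l, Complex.normSq (U k l) * q l = ∑ l, q l := by
      rw [Finset.sum_comm]
      simp only [← Finset.sum_mul, hcol, one_mul]
    simp only [t, mul_add, mul_sub, Finset.sum_add_distrib, Finset.sum_sub_distrib,
      e1, e2, e3, e4]
    linarith
  have ht0 : ∀ k l, t k l = 0 := by
    intro k l
    rw [Finset.sum_eq_zero_iff_of_nonneg fun k _ => Finset.sum_nonneg fun l _ => ht k l] at hsum
    have := hsum k (Finset.mem_univ k)
    rw [Finset.sum_eq_zero_iff_of_nonneg fun l _ => ht k l] at this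
    exact this l (Finset.mem_univ l)
  have hcomm : Matrix.diagonal (fun i => (p i : ℂ)) * U
      = U * Matrix.diagonal (fun i => (q i : ℂ)) := by
    ext k l
    rw [Matrix.diagonal_mul, Matrix.mul_diagonal]
    have : Complex.normSq (U k l) = 0 ∨ p k = q l := by
      rcases (hq l).eq_or_lt with h | h
      · rw [← h]
        exact hsupp k l h.symm
      · exact (mul_eq_zero.mp (ht0 k l)).imp_right (hterm _ _ (hp k) h).2
    rcases this with h | h
    · simp [Complex.normSq_eq_zero.mp h]
    · rw [h, mul_comm]
  calc W * Matrix.diagonal (fun i => (p i : ℂ)) * W.conjTranspose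
      = W * (Matrix.diagonal (fun i => (p i : ℂ)) * U) * V.conjTranspose := by
        rw [hU, mul_assoc, mul_assoc, mul_assoc, mul_assoc, hV₁, mul_one, ← mul_assoc]
    _ = (W * W.conjTranspose) * V * Matrix.diagonal (fun i => (q i : ℂ)) * V.conjTranspose := by
        rw [hcomm]
        simp only [hU, mul_assoc]
    _ = _ := by rw [hW₁, one_mul]

/-- Partial trace over the second tensor factor. -/
def traceSnd {X Y : Type} [Fintype Y] (R : Matrix (X × Y) (X × Y) ℂ) : Matrix X X ℂ :=
  Matrix.of fun x x' => ∑ y, R (x, y) (x', y)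

/-- Partial trace over the first tensor factor. -/
def traceFst {X Y : Type} [Fintype X] (R : Matrix (X × Y) (X × Y) ℂ) : Matrix Y Y ℂ :=
  traceSnd (R.submatrix Prod.swap Prod.swap)

lemma IsDensityMatrix.traceSnd {X Y : Type} [Fintype X] [Fintype Y]
    {R : Matrix (X × Y) (X × Y) ℂ} (hR : IsDensityMatrix R) : IsDensityMatrix (traceSnd R) := by
  constructor
  · have : _root_.traceSnd R = ∑ y, R.submatrix (fun x => (x, y)) (fun x => (x, y)) := by
      ext x x'
      simp [_root_.traceSnd, Matrix.sum_apply]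
    rw [this]
    exact Matrix.posSemidef_sum _ fun y _ => hR.1.submatrix _
  · rw [← hR.2]
    simp [_root_.traceSnd, Matrix.trace, Fintype.sum_prod_type]

lemma IsDensityMatrix.submatrix {X Y : Type} [Fintype X] [Fintype Y]
    {R : Matrix X X ℂ} (hR : IsDensityMatrix R) (e : Y ≃ X) :
    IsDensityMatrix (R.submatrix e e) :=
  ⟨hR.1.submatrix e, by rw [← hR.2]; exact e.sum_comp fun x => R x x⟩

lemma IsDensityMatrix.traceFst {X Y : Type} [Fintype X] [Fintype Y]
    {R : Matrix (X × Y) (X × Y) ℂ} (hR : IsDensityMatrix R) : IsDensityMatrix (traceFst R) :=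
  (hR.submatrix (Equiv.prodComm Y X)).traceSnd

lemma traceSnd_kronecker_one_mul {X Y : Type} [Fintype X] [Fintype Y] [DecidableEq Y]
    (A : Matrix X X ℂ) (R : Matrix (X × Y) (X × Y) ℂ) :
    traceSnd (Matrix.kronecker A 1 * R) = A * traceSnd R := by
  ext x x'
  simp only [traceSnd, Matrix.of_apply, Matrix.mul_apply, Matrix.kronecker,
    Matrix.kroneckerMap_apply, Fintype.sum_prod_type, Matrix.one_apply, mul_ite, mul_one, mul_zero,
    ite_mul, zero_mul, Finset.sum_ite_eq, Finset.mem_univ, if_true, Finset.mul_sum]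
  exact Finset.sum_comm

lemma traceSnd_mul_kronecker_one {X Y : Type} [Fintype X] [Fintype Y] [DecidableEq Y]
    (A : Matrix X X ℂ) (R : Matrix (X × Y) (X × Y) ℂ) :
    traceSnd (R * Matrix.kronecker A 1) = traceSnd R * A := by
  ext x x'
  simp only [traceSnd, Matrix.of_apply, Matrix.mul_apply, Matrix.kronecker,
    Matrix.kroneckerMap_apply, Fintype.sum_prod_type, Matrix.one_apply, mul_ite, mul_one, mul_zero,
    Finset.sum_ite_eq', Finset.mem_univ, if_true, Finset.sum_mul]
  exact Finset.sum_comm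

lemma traceSnd_one_kronecker_mul_comm {X Y : Type} [Fintype X] [DecidableEq X] [Fintype Y]
    (B : Matrix Y Y ℂ) (R : Matrix (X × Y) (X × Y) ℂ) :
    traceSnd (Matrix.kronecker 1 B * R) = traceSnd (R * Matrix.kronecker 1 B) := by
  ext x x'
  simp only [traceSnd, Matrix.of_apply, Matrix.mul_apply, Matrix.kronecker,
    Matrix.kroneckerMap_apply, Fintype.sum_prod_type_right, Matrix.one_apply, ite_mul, one_mul,
    zero_mul, mul_ite, mul_zero, Finset.sum_ite_eq, Finset.sum_ite_eq', Finset.mem_univ, if_true]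
  rw [Finset.sum_comm]
  simp only [mul_comm]

lemma traceSnd_conj_kronecker {X Y : Type} [Fintype X] [DecidableEq X] [Fintype Y]
    [DecidableEq Y] (A : Matrix X X ℂ) {B : Matrix Y Y ℂ} (hB : B ∈ Matrix.unitaryGroup Y ℂ)
    (R : Matrix (X × Y) (X × Y) ℂ) :
    traceSnd ((Matrix.kronecker A B).conjTranspose * R * Matrix.kronecker A B)
      = A.conjTranspose * traceSnd R * A := by
  have h1 : (Matrix.kronecker A B).conjTranspose
      = Matrix.kronecker A.conjTranspose 1 * Matrix.kronecker 1 B.conjTranspose := by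
    simp [Matrix.kronecker, Matrix.conjTranspose_kronecker, ← Matrix.mul_kronecker_mul]
  have h2 : Matrix.kronecker A B = Matrix.kronecker 1 B * Matrix.kronecker A 1 := by
    simp [Matrix.kronecker, ← Matrix.mul_kronecker_mul]
  have h3 : (Matrix.kronecker 1 B * Matrix.kronecker 1 B.conjTranspose :
      Matrix (X × Y) (X × Y) ℂ) = 1 := by
    have hBB : B * B.conjTranspose = 1 := Matrix.mem_unitaryGroup_iff.mp hB
    simp [Matrix.kronecker, ← Matrix.mul_kronecker_mul, hBB]
  rw [h1, h2, ← mul_assoc, traceSnd_mul_kronecker_one, mul_assoc, mul_assoc,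
    traceSnd_kronecker_one_mul, traceSnd_one_kronecker_mul_comm, mul_assoc R, h3, mul_one]

/-- A bipartite state that saturates subadditivity of the entropy is a product state. -/
lemma eq_kronecker_of_matEntropy_eq_add {X Y : Type} [Fintype X] [DecidableEq X] [Fintype Y]
    [DecidableEq Y] {R : Matrix (X × Y) (X × Y) ℂ} (hR : IsDensityMatrix R)
    (hS : matEntropy R = matEntropy (traceSnd R) + matEntropy (traceFst R)) :
    R = Matrix.kronecker (traceSnd R) (traceFst R) := by
  obtain ⟨U, hU, a, ha, hUa⟩ := exists_diagonalization hR.traceSnd.1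
  obtain ⟨V, hV, b, hb, hVb⟩ := exists_diagonalization hR.traceFst.1
  obtain ⟨W, hW, p, hp, hWp⟩ := exists_diagonalization hR.1
  have hsa : ∑ i, a i = 1 := by
    exact_mod_cast (trace_diagonalized hU a).symm.trans (hUa ▸ hR.traceSnd.2)
  have hsb : ∑ j, b j = 1 := by
    exact_mod_cast (trace_diagonalized hV b).symm.trans (hVb ▸ hR.traceFst.2)
  have hsp : ∑ k, p k = 1 := by
    exact_mod_cast (trace_diagonalized hW p).symm.trans (hWp ▸ hR.2)
  set K := Matrix.kronecker U V with hK
  let r : X × Y → ℝ := fun l => ((K.conjTranspose * R * K) l l).re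
  have hUU : U.conjTranspose * U = 1 := Matrix.mem_unitaryGroup_iff'.mp hU
  have hVV : V.conjTranspose * V = 1 := Matrix.mem_unitaryGroup_iff'.mp hV
  have hra : ∀ i, ∑ j, r (i, j) = a i := by
    intro i
    have h := traceSnd_conj_kronecker U hV R
    have hd : U.conjTranspose * (U * Matrix.diagonal (fun i => (a i : ℂ)) * U.conjTranspose) * U
        = Matrix.diagonal (fun i => (a i : ℂ)) := by
      rw [mul_assoc, mul_assoc, mul_assoc, hUU, mul_one, ← mul_assoc, hUU, one_mul]
    rw [hUa, hd] at h
    have := congrArg Complex.re (congrFun (congrFun h i) i)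
    simp only [traceSnd, Matrix.of_apply, Complex.re_sum, Matrix.diagonal_apply_eq,
      Complex.ofReal_re] at this
    exact this
  have hrb : ∀ j, ∑ i, r (i, j) = b j := by
    intro j
    have h := traceSnd_conj_kronecker V hU (R.submatrix Prod.swap Prod.swap)
    have hsw : (Matrix.kronecker V U).conjTranspose * R.submatrix Prod.swap Prod.swap
        * Matrix.kronecker V U = (K.conjTranspose * R * K).submatrix Prod.swap Prod.swap := by
      have e1 : Matrix.kronecker V U = K.submatrix (Equiv.prodComm Y X) (Equiv.prodComm Y X) := by
        ext x y
        simp [hK, mul_comm]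
      rw [e1, Matrix.conjTranspose_submatrix]
      change _ * R.submatrix (Equiv.prodComm Y X) (Equiv.prodComm Y X) * _
        = (K.conjTranspose * R * K).submatrix (Equiv.prodComm Y X) (Equiv.prodComm Y X)
      rw [Matrix.submatrix_mul_equiv, Matrix.submatrix_mul_equiv]
    have hd : V.conjTranspose * (V * Matrix.diagonal (fun i => (b i : ℂ)) * V.conjTranspose) * V
        = Matrix.diagonal (fun i => (b i : ℂ)) := by
      rw [mul_assoc, mul_assoc, mul_assoc, hVV, mul_one, ← mul_assoc, hVV, one_mul]
    rw [hsw, show traceSnd (R.submatrix Prod.swap Prod.swap) = _ from hVb, hd] at h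
    have := congrArg Complex.re (congrFun (congrFun h j) j)
    simp only [traceSnd, Matrix.of_apply, Complex.re_sum, Matrix.diagonal_apply_eq,
      Complex.ofReal_re] at this
    exact this
  have hr0 : ∀ l, 0 ≤ r l := fun l =>
    (Complex.nonneg_iff.mp ((hR.1.conjTranspose_mul_mul_same K).diag_nonneg (i := l))).1
  have hsupp : ∀ i j, a i * b j = 0 → r (i, j) = 0 := by
    intro i j h
    rcases mul_eq_zero.mp h with h | h
    · rw [← hra, Finset.sum_eq_zero_iff_of_nonneg fun j _ => hr0 _] at h
      exact h j (Finset.mem_univ j)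
    · rw [← hrb, Finset.sum_eq_zero_iff_of_nonneg fun j _ => hr0 _] at h
      exact h i (Finset.mem_univ i)
  have hlog : ∑ l, r l * Real.log (a l.1 * b l.2)
      = ∑ i, a i * Real.log (a i) + ∑ j, b j * Real.log (b j) := by
    have : ∀ l : X × Y, r l * Real.log (a l.1 * b l.2)
        = r l * Real.log (a l.1) + r l * Real.log (b l.2) := by
      rintro ⟨i, j⟩
      by_cases h : a i * b j = 0
      · simp [hsupp i j h]
      · rw [Real.log_mul (left_ne_zero_of_mul h) (right_ne_zero_of_mul h), mul_add]
    simp only [this, Finset.sum_add_distrib]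
    congr 1
    · simp only [Fintype.sum_prod_type, ← Finset.sum_mul, hra]
    · simp only [Fintype.sum_prod_type_right, ← Finset.sum_mul, hrb]
  have hSd : ∑ k, p k * Real.log (p k) = ∑ l, r l * Real.log (a l.1 * b l.2) := by
    rw [hUa, hVb, hWp, matEntropy_diagonalized U hU, matEntropy_diagonalized V hV,
      matEntropy_diagonalized W hW] at hS
    simp only [Real.negMulLog, neg_mul, Finset.sum_neg_distrib] at hS
    rw [hlog]
    linarith
  rw [hUa, hVb, kronecker_diagonalized]
  conv_lhs => rw [hWp]
  refine eq_of_klein_eq hW (Matrix.kronecker_mem_unitary hU hV) hp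
    (fun l => mul_nonneg (ha _) (hb _)) ?_ (r := r) ?_ (fun l => hsupp l.1 l.2) hSd
  · rw [hsp, Fintype.sum_prod_type]
    simp only [← Finset.mul_sum, hsb, mul_one, hsa]
  · intro l
    rw [← hWp]
    rfl

lemma isDensityMatrix_vecReduced_flip {X Y : Type} [Fintype X] [Fintype Y] {v : X → Y → ℂ}
    (hv : IsDensityMatrix (vecReduced v)) : IsDensityMatrix (vecReduced (flip v)) := by
  refine ⟨posSemidef_vecReduced _, ?_⟩
  rw [← hv.2]
  simp only [Matrix.trace, vecReduced, Matrix.diag_apply, Matrix.of_apply, flip]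
  exact Finset.sum_comm

lemma matEntropy_le_matEntropy_kronecker {X Y : Type} [Fintype X] [DecidableEq X] [Fintype Y]
    [DecidableEq Y] {A : Matrix X X ℂ} {B : Matrix Y Y ℂ} (hA : IsDensityMatrix A)
    (hB : IsDensityMatrix B) : matEntropy A ≤ matEntropy (Matrix.kronecker A B) := by
  rw [matEntropy_kronecker hA hB]
  exact le_add_of_nonneg_right (matEntropy_nonneg hB)

section Tripartite

variable {A B C X Y Z W : Type}

/-- The vector `φ` on `ABC ⊗ W` split as `A` against the rest. -/
def splitA (φ : A × B × C → W → ℂ) : A → (B × C) × W → ℂ :=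
  fun a q => φ (a, q.1.1, q.1.2) q.2

/-- The vector `φ` on `ABC ⊗ W` split as `B` against the rest. -/
def splitB (φ : A × B × C → W → ℂ) : B → (A × C) × W → ℂ :=
  fun b q => φ (q.1.1, b, q.1.2) q.2

/-- The vector `φ` on `ABC ⊗ W` split as `C` against the rest. -/
def splitC (φ : A × B × C → W → ℂ) : C → (A × B) × W → ℂ :=
  fun c q => φ (q.1.1, q.1.2, c) q.2

/-- The vector `φ` on `ABC ⊗ W` split as `AB` against the rest. -/
def splitAB (φ : A × B × C → W → ℂ) : A × B → C × W → ℂ :=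
  fun u q => φ (u.1, u.2, q.1) q.2

/-- The vector `φ` on `ABC ⊗ XYZ` split as `AX` against the rest. -/
def splitAX (φ : A × B × C → X × Y × Z → ℂ) : A × X → (B × C) × (Y × Z) → ℂ :=
  fun u q => φ (u.1, q.1.1, q.1.2) (u.2, q.2.1, q.2.2)

/-- The vector `φ` on `ABC ⊗ XYZ` split as `BY` against the rest. -/
def splitBY (φ : A × B × C → X × Y × Z → ℂ) : B × Y → (A × C) × (X × Z) → ℂ :=
  fun u q => φ (q.1.1, u.1, q.1.2) (q.2.1, u.2, q.2.2)

/-- The vector `φ` on `ABC ⊗ XYZ` split as `CZ` against the rest. -/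
def splitCZ (φ : A × B × C → X × Y × Z → ℂ) : C × Z → (A × B) × (X × Y) → ℂ :=
  fun u q => φ (q.1.1, q.1.2, u.1) (q.2.1, q.2.2, u.2)

variable [Fintype A] [Fintype B] [Fintype C] [Fintype X] [Fintype Y] [Fintype Z] [Fintype W]
  [DecidableEq A] [DecidableEq B] [DecidableEq C] [DecidableEq X] [DecidableEq Y]
  [DecidableEq Z] [DecidableEq W]

lemma vecReduced_flip_splitC_eq_kronecker {φ : A × B × C → W → ℂ}
    (hφ : IsDensityMatrix (vecReduced φ))
    (hS : matEntropy (vecReduced φ)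
      = matEntropy (vecReduced (splitC φ)) - matEntropy (vecReduced (splitAB φ))) :
    vecReduced (flip (splitC φ))
      = Matrix.kronecker (vecReduced (splitAB φ)) (vecReduced (flip φ)) := by
  have h1 : traceSnd (vecReduced (flip (splitC φ))) = vecReduced (splitAB φ) := by
    ext u u'
    simp only [traceSnd, vecReduced, flip, splitC, splitAB, Matrix.of_apply]
    rw [Fintype.sum_prod_type, Finset.sum_comm]
  have h2 : traceFst (vecReduced (flip (splitC φ))) = vecReduced (flip φ) := by
    ext w w'
    simp [traceFst, traceSnd, vecReduced, flip, splitC, Fintype.sum_prod_type]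
  have hR : IsDensityMatrix (vecReduced (flip (splitC φ))) := by
    refine ⟨posSemidef_vecReduced _, ?_⟩
    rw [← (isDensityMatrix_vecReduced_flip hφ).2, ← h2]
    simp only [Matrix.trace, traceFst, traceSnd, Matrix.diag_apply, Matrix.of_apply,
      Fintype.sum_prod_type_right, Matrix.submatrix_apply, Prod.swap]
  have h := eq_kronecker_of_matEntropy_eq_add hR <| by
    rw [h1, h2, ← matEntropy_vecReduced_flip, ← matEntropy_vecReduced_flip, hS]
    ring
  rwa [h1, h2] at h

lemma add_le_add_of_matEntropy_eq_sub {φ : A × B × C → X × Y × Z → ℂ}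
    (hφ : IsDensityMatrix (vecReduced φ))
    (hS : matEntropy (vecReduced φ)
      = matEntropy (vecReduced (splitC φ)) - matEntropy (vecReduced (splitAB φ))) :
    matEntropy (vecReduced (splitA φ)) + matEntropy (vecReduced (splitB φ))
        + matEntropy (vecReduced (splitAB φ))
      ≤ matEntropy (vecReduced (splitAX φ)) + matEntropy (vecReduced (splitBY φ))
        + matEntropy (vecReduced (splitCZ φ)) := by
  have hprod := vecReduced_flip_splitC_eq_kronecker hφ hS
  have hentry : ∀ a a' b b' w w', ∑ c, φ (a, b, c) w * star (φ (a', b', c) w')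
      = vecReduced (splitAB φ) (a, b) (a', b') * vecReduced (flip φ) w w' :=
    fun a a' b b' w w' => congrFun (congrFun hprod ((a, b), w)) ((a', b'), w')
  have hT := isDensityMatrix_vecReduced_flip hφ
  have hL : IsDensityMatrix (vecReduced (splitAB φ)) := by
    refine ⟨posSemidef_vecReduced _, ?_⟩
    rw [← hφ.2]
    simp [Matrix.trace, vecReduced, splitAB, Fintype.sum_prod_type]
  have hA : vecReduced (splitA φ) = traceSnd (vecReduced (splitAB φ)) := by
    ext a a'
    simp [traceSnd, vecReduced, splitA, splitAB, Fintype.sum_prod_type]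
  have hB : vecReduced (splitB φ) = traceFst (vecReduced (splitAB φ)) := by
    ext a a'
    simp [traceFst, traceSnd, vecReduced, splitB, splitAB, Fintype.sum_prod_type]
  let eY : Y × X × Z ≃ X × Y × Z :=
    ⟨fun p => (p.2.1, p.1, p.2.2), fun p => (p.2.1, p.1, p.2.2), fun _ => rfl, fun _ => rfl⟩
  have hAX : vecReduced (splitAX φ)
      = Matrix.kronecker (vecReduced (splitA φ)) (traceSnd (vecReduced (flip φ))) := by
    ext ⟨a, x⟩ ⟨a', x'⟩
    rw [hA]
    simp only [Matrix.kronecker, Matrix.kroneckerMap_apply, traceSnd, Matrix.of_apply,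
      Finset.sum_mul_sum, ← hentry]
    simp only [vecReduced, splitAX, Matrix.of_apply, Fintype.sum_prod_type]
    refine Finset.sum_congr rfl fun b _ => ?_
    rw [Finset.sum_comm]
    refine Finset.sum_congr rfl fun y _ => Finset.sum_comm
  have hBY : vecReduced (splitBY φ) = Matrix.kronecker (vecReduced (splitB φ))
      (traceSnd ((vecReduced (flip φ)).submatrix eY eY)) := by
    ext ⟨b, y⟩ ⟨b', y'⟩
    rw [hB]
    simp only [Matrix.kronecker, Matrix.kroneckerMap_apply, traceFst, traceSnd, Matrix.of_apply,
      Finset.sum_mul_sum, Matrix.submatrix_apply, Prod.swap, eY, Equiv.coe_fn_mk, ← hentry]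
    simp only [vecReduced, splitBY, Matrix.of_apply, Fintype.sum_prod_type]
    refine Finset.sum_congr rfl fun a _ => ?_
    rw [Finset.sum_comm]
    refine Finset.sum_congr rfl fun y _ => Finset.sum_comm
  have hCZ : vecReduced (flip (splitCZ φ)) = Matrix.kronecker (vecReduced (splitAB φ))
      (traceSnd ((vecReduced (flip φ)).submatrix (Equiv.prodAssoc X Y Z)
        (Equiv.prodAssoc X Y Z))) := by
    ext ⟨⟨a, b⟩, x, y⟩ ⟨⟨a', b'⟩, x', y'⟩
    simp only [Matrix.kronecker, Matrix.kroneckerMap_apply, traceSnd, Matrix.of_apply,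
      Finset.mul_sum, Matrix.submatrix_apply, Equiv.prodAssoc_apply, ← hentry]
    simp only [vecReduced, flip, splitCZ, Matrix.of_apply, Fintype.sum_prod_type]
    exact Finset.sum_comm
  rw [matEntropy_vecReduced_flip (splitCZ φ), hAX, hBY, hCZ]
  gcongr
  · exact matEntropy_le_matEntropy_kronecker (hA ▸ hL.traceSnd) hT.traceSnd
  · exact matEntropy_le_matEntropy_kronecker (hB ▸ hL.traceFst) (hT.submatrix eY).traceSnd
  · exact matEntropy_le_matEntropy_kronecker hL (hT.submatrix _).traceSnd

end Tripartite

section Systems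

variable {α δ : Fin 3 → Type} [∀ i, Fintype (α i)] [∀ i, DecidableEq (α i)]
  [∀ i, Fintype (δ i)] [∀ i, DecidableEq (δ i)]

lemma matEntropy_eq_of_purification {W : Type} [Fintype W]
    {ρ : Matrix (∀ i, α i) (∀ i, α i) ℂ} {φ : α 0 × α 1 × α 2 → W → ℂ}
    (hρ : ∀ f g, ρ (piThree α f) (piThree α g) = vecReduced φ f g) :
    matEntropy ρ = matEntropy (vecReduced φ) := by
  rw [← matEntropy_submatrix ρ (piThree α)]
  congr 1
  ext f g
  exact hρ f g

lemma matEntropy_reduce_zero [Nonempty (∀ i, α i)] {W : Type} [Fintype W]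
    {ρ : Matrix (∀ i, α i) (∀ i, α i) ℂ} {φ : α 0 × α 1 × α 2 → W → ℂ}
    (hρ : ∀ f g, ρ (piThree α f) (piThree α g) = vecReduced φ f g) :
    matEntropy (reduce {0} ρ) = matEntropy (vecReduced (splitA φ)) := by
  obtain ⟨t⟩ := ‹Nonempty (∀ i, α i)›
  have : ∀ i, Nonempty (α i) := fun i => ⟨t i⟩
  rw [matEntropy_reduce {0} ρ (X := α 0) (Y := α 1 × α 2) (piThree α)]
  · simp only [hρ, vecReduced, splitA, Matrix.of_apply, Fintype.sum_prod_type]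
  · intro x y y' i hi
    fin_cases i <;> first | rfl | simp at hi
  · intro x y y' i hi
    fin_cases i <;> first | rfl | simp at hi

lemma matEntropy_reduce_one [Nonempty (∀ i, α i)] {W : Type} [Fintype W]
    {ρ : Matrix (∀ i, α i) (∀ i, α i) ℂ} {φ : α 0 × α 1 × α 2 → W → ℂ}
    (hρ : ∀ f g, ρ (piThree α f) (piThree α g) = vecReduced φ f g) :
    matEntropy (reduce {1} ρ) = matEntropy (vecReduced (splitB φ)) := by
  obtain ⟨t⟩ := ‹Nonempty (∀ i, α i)›
  have : ∀ i, Nonempty (α i) := fun i => ⟨t i⟩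
  let e : α 1 × α 0 × α 2 ≃ α 0 × α 1 × α 2 :=
    ⟨fun p => (p.2.1, p.1, p.2.2), fun p => (p.2.1, p.1, p.2.2), fun _ => rfl, fun _ => rfl⟩
  rw [matEntropy_reduce {1} ρ (e.trans (piThree α))]
  · simp only [Equiv.trans_apply, hρ, vecReduced, splitB, Matrix.of_apply, Fintype.sum_prod_type,
      e, Equiv.coe_fn_mk]
  · intro x y y' i hi
    fin_cases i <;> first | rfl | simp at hi
  · intro x y y' i hi
    fin_cases i <;> first | rfl | simp at hi

lemma matEntropy_reduce_two [Nonempty (∀ i, α i)] {W : Type} [Fintype W]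
    {ρ : Matrix (∀ i, α i) (∀ i, α i) ℂ} {φ : α 0 × α 1 × α 2 → W → ℂ}
    (hρ : ∀ f g, ρ (piThree α f) (piThree α g) = vecReduced φ f g) :
    matEntropy (reduce {2} ρ) = matEntropy (vecReduced (splitC φ)) := by
  obtain ⟨t⟩ := ‹Nonempty (∀ i, α i)›
  have : ∀ i, Nonempty (α i) := fun i => ⟨t i⟩
  let e : α 2 × α 0 × α 1 ≃ α 0 × α 1 × α 2 :=
    ⟨fun p => (p.2.1, p.2.2, p.1), fun p => (p.2.2, p.1, p.2.1), fun _ => rfl, fun _ => rfl⟩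
  rw [matEntropy_reduce {2} ρ (e.trans (piThree α))]
  · simp only [Equiv.trans_apply, hρ, vecReduced, splitC, Matrix.of_apply, Fintype.sum_prod_type,
      e, Equiv.coe_fn_mk]
  · intro x y y' i hi
    fin_cases i <;> first | rfl | simp at hi
  · intro x y y' i hi
    fin_cases i <;> first | rfl | simp at hi

lemma matEntropy_reduce_zero_one [Nonempty (∀ i, α i)] {W : Type} [Fintype W]
    {ρ : Matrix (∀ i, α i) (∀ i, α i) ℂ} {φ : α 0 × α 1 × α 2 → W → ℂ}
    (hρ : ∀ f g, ρ (piThree α f) (piThree α g) = vecReduced φ f g) :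
    matEntropy (reduce ({0, 1} : Finset (Fin 3)) ρ) = matEntropy (vecReduced (splitAB φ)) := by
  obtain ⟨t⟩ := ‹Nonempty (∀ i, α i)›
  have : ∀ i, Nonempty (α i) := fun i => ⟨t i⟩
  rw [matEntropy_reduce {0, 1} ρ ((Equiv.prodAssoc (α 0) (α 1) (α 2)).trans (piThree α))]
  · simp only [Equiv.trans_apply, hρ, vecReduced, splitAB, Matrix.of_apply, Fintype.sum_prod_type,
      Equiv.prodAssoc_apply]
  · intro x y y' i hi
    fin_cases i <;> first | rfl | simp at hi
  · intro x y y' i hi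
    fin_cases i <;> first | rfl | simp at hi

/-- Amplitudes of a vector on three systems and three ancillas, as a function of triples. -/
def amplitude (ψ : (∀ i : Fin 3 ⊕ Fin 3, Sum.elim α δ i) → ℂ) :
    α 0 × α 1 × α 2 → δ 0 × δ 1 × δ 2 → ℂ :=
  fun f h => ψ (mergeSum (piThree α f) (piThree δ h))

/-- Assignments on three systems and three ancillas as pairs of triples. -/
def mergeEquiv (α δ : Fin 3 → Type) :
    (α 0 × α 1 × α 2) × (δ 0 × δ 1 × δ 2) ≃ ∀ i : Fin 3 ⊕ Fin 3, Sum.elim α δ i where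
  toFun p := mergeSum (piThree α p.1) (piThree δ p.2)
  invFun t := ((t (.inl 0), t (.inl 1), t (.inl 2)), (t (.inr 0), t (.inr 1), t (.inr 2)))
  left_inv _ := rfl
  right_inv t := by
    funext i
    rcases i with i | i <;> fin_cases i <;> rfl

variable [∀ i, Nonempty (α i)] [∀ i, Nonempty (δ i)]

lemma matEntropy_reduce_party_zero (ψ : (∀ i : Fin 3 ⊕ Fin 3, Sum.elim α δ i) → ℂ) :
    matEntropy (reduce (partyFinset id 0) (vecState ψ))
      = matEntropy (vecReduced (splitAX (amplitude ψ))) := by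
  let e : (α 0 × δ 0) × ((α 1 × α 2) × (δ 1 × δ 2)) ≃ (α 0 × α 1 × α 2) × (δ 0 × δ 1 × δ 2) :=
    ⟨fun p => ((p.1.1, p.2.1), (p.1.2, p.2.2)), fun p => ((p.1.1, p.2.1), (p.1.2, p.2.2)),
      fun _ => rfl, fun _ => rfl⟩
  rw [matEntropy_reduce _ _ (e.trans (mergeEquiv α δ))]
  · rfl
  all_goals
    rintro x y y' (i | i) hi <;> fin_cases i <;> first | rfl | simp [partyFinset] at hi

lemma matEntropy_reduce_party_one (ψ : (∀ i : Fin 3 ⊕ Fin 3, Sum.elim α δ i) → ℂ) :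
    matEntropy (reduce (partyFinset id 1) (vecState ψ))
      = matEntropy (vecReduced (splitBY (amplitude ψ))) := by
  let e : (α 1 × δ 1) × ((α 0 × α 2) × (δ 0 × δ 2)) ≃ (α 0 × α 1 × α 2) × (δ 0 × δ 1 × δ 2) :=
    ⟨fun p => ((p.2.1.1, p.1.1, p.2.1.2), (p.2.2.1, p.1.2, p.2.2.2)),
      fun p => ((p.1.2.1, p.2.2.1), ((p.1.1, p.1.2.2), (p.2.1, p.2.2.2))),
      fun _ => rfl, fun _ => rfl⟩
  rw [matEntropy_reduce _ _ (e.trans (mergeEquiv α δ))]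
  · rfl
  all_goals
    rintro x y y' (i | i) hi <;> fin_cases i <;> first | rfl | simp [partyFinset] at hi

lemma matEntropy_reduce_party_two (ψ : (∀ i : Fin 3 ⊕ Fin 3, Sum.elim α δ i) → ℂ) :
    matEntropy (reduce (partyFinset id 2) (vecState ψ))
      = matEntropy (vecReduced (splitCZ (amplitude ψ))) := by
  let e : (α 2 × δ 2) × ((α 0 × α 1) × (δ 0 × δ 1)) ≃ (α 0 × α 1 × α 2) × (δ 0 × δ 1 × δ 2) :=
    ⟨fun p => ((p.2.1.1, p.2.1.2, p.1.1), (p.2.2.1, p.2.2.2, p.1.2)),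
      fun p => ((p.1.2.2, p.2.2.2), ((p.1.1, p.1.2.1), (p.2.1, p.2.2.1))),
      fun _ => rfl, fun _ => rfl⟩
  rw [matEntropy_reduce _ _ (e.trans (mergeEquiv α δ))]
  · rfl
  all_goals
    rintro x y y' (i | i) hi <;> fin_cases i <;> first | rfl | simp [partyFinset] at hi

lemma matEntropy_splitAX_of_subsingleton {A B C X Y Z : Type} [Fintype A] [DecidableEq A]
    [Fintype B] [Fintype C] [Fintype X] [DecidableEq X] [Fintype Y] [Fintype Z] [Nonempty X]
    [Subsingleton X] (φ : A × B × C → X × Y × Z → ℂ) :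
    matEntropy (vecReduced (splitAX φ)) = matEntropy (vecReduced (splitA φ)) := by
  obtain ⟨x₀⟩ := ‹Nonempty X›
  have : Unique X := ⟨⟨x₀⟩, fun _ => Subsingleton.elim _ _⟩
  rw [← matEntropy_submatrix _ (Equiv.prodUnique A X)]
  congr 1
  ext ⟨a, x⟩ ⟨a', x'⟩
  obtain rfl := Unique.eq_default x
  obtain rfl := Unique.eq_default x'
  simp [vecReduced, splitAX, splitA, Fintype.sum_prod_type]

lemma matEntropy_splitBY_of_subsingleton {A B C X Y Z : Type} [Fintype B] [DecidableEq B]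
    [Fintype A] [Fintype C] [Fintype Y] [DecidableEq Y] [Fintype X] [Fintype Z] [Nonempty Y]
    [Subsingleton Y] (φ : A × B × C → X × Y × Z → ℂ) :
    matEntropy (vecReduced (splitBY φ)) = matEntropy (vecReduced (splitB φ)) := by
  obtain ⟨y₀⟩ := ‹Nonempty Y›
  have : Unique Y := ⟨⟨y₀⟩, fun _ => Subsingleton.elim _ _⟩
  rw [← matEntropy_submatrix _ (Equiv.prodUnique B Y)]
  congr 1
  ext ⟨b, y⟩ ⟨b', y'⟩
  obtain rfl := Unique.eq_default y
  obtain rfl := Unique.eq_default y'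
  simp [vecReduced, splitBY, splitB, Fintype.sum_prod_type]

lemma matEntropy_splitCZ_of_subsingleton {A B C X Y Z : Type} [Fintype A] [DecidableEq A]
    [Fintype B] [DecidableEq B] [Fintype C] [DecidableEq C] [Fintype X] [DecidableEq X]
    [Fintype Y] [DecidableEq Y] [Fintype Z] [DecidableEq Z] [Nonempty X] [Subsingleton X]
    [Nonempty Y] [Subsingleton Y] (φ : A × B × C → X × Y × Z → ℂ) :
    matEntropy (vecReduced (splitCZ φ)) = matEntropy (vecReduced (splitAB φ)) := by
  obtain ⟨x₀⟩ := ‹Nonempty X›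
  obtain ⟨y₀⟩ := ‹Nonempty Y›
  have : Unique (X × Y) := ⟨⟨(x₀, y₀)⟩, fun _ => Subsingleton.elim _ _⟩
  rw [matEntropy_vecReduced_flip, ← matEntropy_submatrix _ (Equiv.prodUnique (A × B) (X × Y))]
  congr 1
  ext ⟨u, x⟩ ⟨u', x'⟩
  obtain rfl := Unique.eq_default x
  obtain rfl := Unique.eq_default x'
  have hdef : (default : X × Y) = (x₀, y₀) := Subsingleton.elim _ _
  simp [vecReduced, flip, splitCZ, splitAB, Fintype.sum_prod_type, hdef,
    Fintype.sum_subsingleton _ x₀, Fintype.sum_subsingleton _ y₀]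

end Systems

lemma Purifies.eq_vecReduced {α : Fin 3 → Type} [∀ i, Fintype (α i)] {d : Fin 3 → ℕ}
    {ψ : (∀ i : Fin 3 ⊕ Fin 3, Sum.elim α (fun k => Fin (d k)) i) → ℂ}
    {ρ : Matrix (∀ i, α i) (∀ i, α i) ℂ} (h : Purifies ψ ρ) (f g : α 0 × α 1 × α 2) :
    ρ (piThree α f) (piThree α g) = vecReduced (amplitude ψ) f g := by
  rw [← h, ← (piThree fun k => Fin (d k)).sum_comp]
  rfl

/-- The canonical purification, with the whole purifying system held by the third party. -/
lemma exists_purifies {α : Fin 3 → Type} [∀ i, Fintype (α i)] [∀ i, DecidableEq (α i)]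
    {ρ : Matrix (∀ i, α i) (∀ i, α i) ℂ} (hρ : ρ.PosSemidef) :
    ∃ (d : Fin 3 → ℕ) (ψ : (∀ i : Fin 3 ⊕ Fin 3, Sum.elim α (fun k => Fin (d k)) i) → ℂ),
      d 0 = 1 ∧ d 1 = 1 ∧ Purifies ψ ρ := by
  obtain ⟨U, -, p, hp, hUp⟩ := exists_diagonalization hρ
  let e := Fintype.equivFin (∀ i, α i)
  let M : Matrix (∀ i, α i) (∀ i, α i) ℂ :=
    U * Matrix.diagonal fun i => (Real.sqrt (p i) : ℂ)
  have hM : M * M.conjTranspose = ρ := by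
    rw [hUp, Matrix.conjTranspose_mul, Matrix.diagonal_conjTranspose, mul_assoc, mul_assoc,
      ← mul_assoc (Matrix.diagonal _), Matrix.diagonal_mul_diagonal]
    congr 3
    ext i
    simp [← Complex.ofReal_mul, Real.mul_self_sqrt (hp i)]
  refine ⟨![1, 1, Fintype.card (∀ i, α i)],
    fun t => M (fun i => t (.inl i)) (e.symm (t (.inr 2))), rfl, rfl, fun f g => ?_⟩
  rw [← (piThree fun k => Fin (![1, 1, Fintype.card (∀ i, α i)] k)).sum_comp, ← hM,
    Matrix.mul_apply, ← e.symm.sum_comp]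
  change ∑ h : Fin 1 × Fin 1 × Fin (Fintype.card (∀ i, α i)),
    M f (e.symm h.2.2) * star (M g (e.symm h.2.2)) = _
  simp [Fintype.sum_prod_type, Matrix.conjTranspose_apply]

/-- if a tripartite state saturates subadditivity in the form
`S_{ABC} = S_C − S_{AB}`, then `Δ_P(A:B:C) = S_A + S_B + S_{AB}`.
Subsystems `A, B, C` are indexed by `0, 1, 2 : Fin 3`. -/
theorem DeltaP_of_saturated_subadditivity {α : Fin 3 → Type}
    [∀ i, Fintype (α i)] [∀ i, DecidableEq (α i)]
    (ρ : Matrix (∀ i, α i) (∀ i, α i) ℂ) (hρ : IsDensityMatrix ρ)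
    (hsat : matEntropy ρ
      = matEntropy (reduce {2} ρ) - matEntropy (reduce ({0, 1} : Finset (Fin 3)) ρ)) :
    DeltaPart id ρ = matEntropy (reduce {0} ρ) + matEntropy (reduce {1} ρ)
      + matEntropy (reduce ({0, 1} : Finset (Fin 3)) ρ) := by
  have hne : Nonempty (∀ i, α i) := by
    by_contra h
    rw [not_nonempty_iff] at h
    simpa [Matrix.trace] using hρ.2
  have : ∀ i, Nonempty (α i) := fun i => hne.map fun t => t i
  have hnonempty : ∀ (d : Fin 3 → ℕ)
      (ψ : (∀ i : Fin 3 ⊕ Fin 3, Sum.elim α (fun k => Fin (d k)) i) → ℂ),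
      Purifies ψ ρ → ∀ k, Nonempty (Fin (d k)) := by
    intro d ψ h k
    by_contra hk
    rw [not_nonempty_iff] at hk
    have hempty : IsEmpty (∀ k, Fin (d k)) := ⟨fun t => hk.false (t k)⟩
    have hzero : ρ = 0 := by
      ext f g
      simp [← h f g]
    simpa [hzero] using hρ.2
  have hsum : ∀ (d : Fin 3 → ℕ)
      (ψ : (∀ i : Fin 3 ⊕ Fin 3, Sum.elim α (fun k => Fin (d k)) i) → ℂ), Purifies ψ ρ →
      ∑ k : Fin 3, matEntropy (reduce (partyFinset id k) (vecState ψ))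
        = matEntropy (vecReduced (splitAX (amplitude ψ)))
          + matEntropy (vecReduced (splitBY (amplitude ψ)))
          + matEntropy (vecReduced (splitCZ (amplitude ψ))) := by
    intro d ψ h
    have := hnonempty d ψ h
    rw [Fin.sum_univ_three, matEntropy_reduce_party_zero, matEntropy_reduce_party_one,
      matEntropy_reduce_party_two]
  refine IsLeast.csInf_eq ⟨?_, ?_⟩
  · obtain ⟨d, ψ, h0, h1, h⟩ := exists_purifies hρ.1
    refine ⟨d, ψ, h, ?_⟩
    have := hnonempty d ψ h
    have : Subsingleton (Fin (d 0)) := by rw [h0]; infer_instance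
    have : Subsingleton (Fin (d 1)) := by rw [h1]; infer_instance
    rw [hsum d ψ h, matEntropy_splitAX_of_subsingleton, matEntropy_splitBY_of_subsingleton,
      matEntropy_splitCZ_of_subsingleton, matEntropy_reduce_zero h.eq_vecReduced,
      matEntropy_reduce_one h.eq_vecReduced, matEntropy_reduce_zero_one h.eq_vecReduced]
  · rintro x ⟨d, ψ, h, rfl⟩
    rw [hsum d ψ h, matEntropy_reduce_zero h.eq_vecReduced,
      matEntropy_reduce_one h.eq_vecReduced, matEntropy_reduce_zero_one h.eq_vecReduced]
    rw [matEntropy_eq_of_purification h.eq_vecReduced, matEntropy_reduce_two h.eq_vecReduced,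
      matEntropy_reduce_zero_one h.eq_vecReduced] at hsat
    refine add_le_add_of_matEntropy_eq_sub ?_ hsat
    have hφ : vecReduced (amplitude ψ) = ρ.submatrix (piThree α) (piThree α) := by
      ext f g
      exact (h.eq_vecReduced f g).symm
    exact hφ ▸ IsDensityMatrix.submatrix hρ (piThree α)
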